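/- Let d ∈ ℕ, let B = B_d(0,1) ⊆ ℝ^d be the open unit ball, and let S^∞(T*B) = ⋃_{m∈ℝ} S^m(T*B). There exists a ℂ-linear map E : S^∞(T*B) → C^∞(ℝ^d × ℝ^d) such that: (1) for every m ∈ ℝ and every a ∈ S^m(T*B), Ea ∈ S^m(T*ℝ^d) and (Ea)(x,k) = a(x,k) for all (x,k) ∈ B × ℝ^d; (2) for every m ∈ ℝ and all multi-indices α, β ∈ ℕ^d there exist a constant C and a finite family of multi-index pairs (αᵢ, βᵢ) such that for every a ∈ S^m(T*B), sup_{(x,k)} ⟨k⟩^{−m+|β|}|∂ₓ^α∂ₖ^β (Ea)(x,k)| ≤ C·maxᵢ sup_{(x,k)∈B×ℝ^d} ⟨k⟩^{−m+|βᵢ|}|∂ₓ^{αᵢ}∂ₖ^{βᵢ} a(x,k)|. -/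

import Mathlib

noncomputable section

/-- Directional derivative of `f` along the vector `v`. -/
def pdir {E F : Type*} [NormedAddCommGroup E] [NormedSpace ℝ E]
    [NormedAddCommGroup F] [NormedSpace ℝ F] (v : E) (f : E → F) : E → F :=
  fun x => fderiv ℝ f x v

/-- Multi-index iterated directional derivative: apply `(α j)`-fold differentiation along
`e j` for each `j`. -/
def pmulti {E F : Type*} [NormedAddCommGroup E] [NormedSpace ℝ E]
    [NormedAddCommGroup F] [NormedSpace ℝ F] {d : ℕ}
    (e : Fin d → E) (α : Fin d → ℕ) (f : E → F) : E → F :=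
  (List.finRange d).foldr (fun j g => (pdir (e j))^[α j] g) f

/-- The `x_j`-directions in `ℝ^d × ℝ^d`. -/
def dirX (d : ℕ) (j : Fin d) : EuclideanSpace ℝ (Fin d) × EuclideanSpace ℝ (Fin d) :=
  (EuclideanSpace.single j 1, 0)

/-- The `k_j`-directions in `ℝ^d × ℝ^d`. -/
def dirK (d : ℕ) (j : Fin d) : EuclideanSpace ℝ (Fin d) × EuclideanSpace ℝ (Fin d) :=
  (0, EuclideanSpace.single j 1)

/-- The mixed partial derivative `∂ₓ^α ∂ₖ^β`. -/
def Dmix (d : ℕ) (α β : Fin d → ℕ)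
    (f : EuclideanSpace ℝ (Fin d) × EuclideanSpace ℝ (Fin d) → ℂ) :
    EuclideanSpace ℝ (Fin d) × EuclideanSpace ℝ (Fin d) → ℂ :=
  pmulti (dirX d) α (pmulti (dirK d) β f)

/-- The uniform symbol class `S^m(T*U)` for `U ⊆ ℝ^d` open: functions `a(x,k)` smooth on
`U × ℝ^d` with `|∂ₓ^α ∂ₖ^β a(x,k)| ≤ C·⟨k⟩^(m−|β|)` there. -/
def SymbOn (d : ℕ) (U : Set (EuclideanSpace ℝ (Fin d))) (m : ℝ)
    (a : EuclideanSpace ℝ (Fin d) × EuclideanSpace ℝ (Fin d) → ℂ) : Prop :=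
  ContDiffOn ℝ (⊤ : ℕ∞) a (U ×ˢ Set.univ) ∧
  ∀ α β : Fin d → ℕ, ∃ C : ℝ,
    ∀ p ∈ U ×ˢ (Set.univ : Set (EuclideanSpace ℝ (Fin d))),
      ‖Dmix d α β a p‖ ≤ C * (1 + ‖p.2‖ ^ 2) ^ ((m - ∑ j, (β j : ℝ)) / 2)

/-- Iterated directional derivative along a word: the first letter is applied first. -/
def wordDeriv {ι E F : Type*} [NormedAddCommGroup E] [NormedSpace ℝ E]
    [NormedAddCommGroup F] [NormedSpace ℝ F] (e : ι → E) (L : List ι) (f : E → F) : E → F :=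
  L.foldl (fun g i => pdir (e i) g) f

section WordDeriv

variable {ι E F : Type*} [NormedAddCommGroup E] [NormedSpace ℝ E]
  [NormedAddCommGroup F] [NormedSpace ℝ F]

@[simp] lemma wordDeriv_nil (e : ι → E) (f : E → F) : wordDeriv e [] f = f := rfl

@[simp] lemma wordDeriv_cons (e : ι → E) (i : ι) (L : List ι) (f : E → F) :
    wordDeriv e (i :: L) f = wordDeriv e L (pdir (e i) f) := rfl

lemma wordDeriv_append (e : ι → E) (L L' : List ι) (f : E → F) :
    wordDeriv e (L ++ L') f = wordDeriv e L' (wordDeriv e L f) := by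
  simp [wordDeriv]

lemma wordDeriv_map {κ : Type*} (e : ι → E) (φ : κ → ι) (L : List κ) (f : E → F) :
    wordDeriv e (L.map φ) f = wordDeriv (fun k => e (φ k)) L f := by
  simp [wordDeriv, List.foldl_map]

lemma ContDiff.pdir {f : E → F} (hf : ContDiff ℝ (⊤ : ℕ∞) f) (v : E) :
    ContDiff ℝ (⊤ : ℕ∞) (pdir v f) :=
  (hf.fderiv_right (by simp)).clm_apply contDiff_const

lemma ContDiffOn.pdir {f : E → F} {U : Set E} (hU : IsOpen U)
    (hf : ContDiffOn ℝ (⊤ : ℕ∞) f U) (v : E) : ContDiffOn ℝ (⊤ : ℕ∞) (pdir v f) U :=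
  (hf.fderiv_of_isOpen hU (by simp)).clm_apply contDiffOn_const

lemma ContDiff.wordDeriv {f : E → F} (hf : ContDiff ℝ (⊤ : ℕ∞) f) (e : ι → E) (L : List ι) :
    ContDiff ℝ (⊤ : ℕ∞) (wordDeriv e L f) := by
  induction L generalizing f with
  | nil => exact hf
  | cons i L ih => exact ih (hf.pdir _)

lemma Set.EqOn.pdir {f g : E → F} {U : Set E} (hU : IsOpen U) (h : Set.EqOn f g U) (v : E) :
    Set.EqOn (pdir v f) (pdir v g) U := fun x hx => by
  have : f =ᶠ[nhds x] g := Filter.eventuallyEq_of_mem (hU.mem_nhds hx) h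
  simp only [_root_.pdir, this.fderiv_eq]

lemma Set.EqOn.wordDeriv {f g : E → F} {U : Set E} (hU : IsOpen U) (h : Set.EqOn f g U)
    (e : ι → E) (L : List ι) : Set.EqOn (wordDeriv e L f) (wordDeriv e L g) U := by
  induction L generalizing f g with
  | nil => exact h
  | cons i L ih => exact ih (h.pdir hU _)

lemma pdir_comm {f : E → F} {U : Set E} (hU : IsOpen U)
    (hf : ContDiffOn ℝ (⊤ : ℕ∞) f U) (v w : E) :
    Set.EqOn (pdir v (pdir w f)) (pdir w (pdir v f)) U := fun x hx => by
  have hfx : ContDiffAt ℝ (⊤ : ℕ∞) f x := hf.contDiffAt (hU.mem_nhds hx)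
  have hd : DifferentiableAt ℝ (fderiv ℝ f) x :=
    (hfx.fderiv_right (m := 1) (by norm_cast)).differentiableAt (by simp)
  have hs := hfx.isSymmSndFDerivAt (by rw [minSmoothness_of_isRCLikeNormedField]; norm_cast)
  have key : ∀ a b : E, pdir a (pdir b f) x = fderiv ℝ (fderiv ℝ f) x a b := fun a b => by
    unfold pdir
    rw [fderiv_clm_apply hd (differentiableAt_const b)]
    simp
  rw [key, key]
  exact hs v w

lemma wordDeriv_perm {L L' : List ι} (h : L.Perm L') {f : E → F} {U : Set E} (hU : IsOpen U)
    (hf : ContDiffOn ℝ (⊤ : ℕ∞) f U) (e : ι → E) :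
    Set.EqOn (wordDeriv e L f) (wordDeriv e L' f) U := by
  induction h generalizing f with
  | nil => exact fun _ _ => rfl
  | cons i _ ih => exact ih (hf.pdir hU _)
  | swap i j L => exact (pdir_comm hU hf _ _).wordDeriv hU e L
  | trans _ _ ih₁ ih₂ => exact (ih₁ hf).trans (ih₂ hf)

lemma pdir_add {f g : E → F} (hf : ContDiff ℝ (⊤ : ℕ∞) f) (hg : ContDiff ℝ (⊤ : ℕ∞) g) (v : E) :
    pdir v (f + g) = pdir v f + pdir v g := by
  ext x
  simp [pdir, fderiv_add (hf.differentiable (by simp) x) (hg.differentiable (by simp) x)]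

lemma pdir_const_smul {f : E → F} (hf : ContDiff ℝ (⊤ : ℕ∞) f) (c : ℝ) (v : E) :
    pdir v (c • f) = c • pdir v f := by
  ext x
  simp [pdir, fderiv_const_smul (hf.differentiable (by simp) x)]

lemma wordDeriv_add {f g : E → F} (hf : ContDiff ℝ (⊤ : ℕ∞) f) (hg : ContDiff ℝ (⊤ : ℕ∞) g)
    (e : ι → E) (L : List ι) :
    wordDeriv e L (f + g) = wordDeriv e L f + wordDeriv e L g := by
  induction L generalizing f g with
  | nil => rfl
  | cons i L ih => simp only [wordDeriv_cons, pdir_add hf hg, ih (hf.pdir _) (hg.pdir _)]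

lemma wordDeriv_const_smul {f : E → F} (hf : ContDiff ℝ (⊤ : ℕ∞) f) (c : ℝ)
    (e : ι → E) (L : List ι) :
    wordDeriv e L (c • f) = c • wordDeriv e L f := by
  induction L generalizing f with
  | nil => rfl
  | cons i L ih => simp only [wordDeriv_cons, pdir_const_smul hf, ih (hf.pdir _)]

lemma wordDeriv_replicate (e : ι → E) (i : ι) (n : ℕ) (f : E → F) :
    wordDeriv e (List.replicate n i) f = (pdir (e i))^[n] f := by
  induction n generalizing f with
  | zero => rfl
  | succ n ih => simp [List.replicate_succ, ih]

end WordDeriv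

/-- The word whose `wordDeriv` is the multi-index derivative `pmulti`. -/
def indexWord {d : ℕ} (α : Fin d → ℕ) : List (Fin d) :=
  (List.finRange d).foldr (fun j L => L ++ List.replicate (α j) j) []

lemma pmulti_eq_wordDeriv {E F : Type*} [NormedAddCommGroup E] [NormedSpace ℝ E]
    [NormedAddCommGroup F] [NormedSpace ℝ F] {d : ℕ} (e : Fin d → E) (α : Fin d → ℕ) (f : E → F) :
    pmulti e α f = wordDeriv e (indexWord α) f := by
  unfold pmulti indexWord
  induction List.finRange d with
  | nil => rfl
  | cons j l ih => simp only [List.foldr_cons, wordDeriv_append, wordDeriv_replicate, ih]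

lemma count_indexWord {d : ℕ} (α : Fin d → ℕ) (i : Fin d) : (indexWord α).count i = α i := by
  have key : ∀ l : List (Fin d), (l.foldr (fun j L => L ++ List.replicate (α j) j) []).count i =
      l.count i * α i := by
    intro l
    induction l with
    | nil => simp
    | cons j l ih =>
      simp only [List.foldr_cons, List.count_append, ih, List.count_replicate, List.count_cons]
      by_cases h : j = i
      · subst h; simp; ring
      · simp [h]
  unfold indexWord
  rw [key, List.count_eq_one_of_mem (List.nodup_finRange d) (List.mem_finRange i), one_mul]

/-- The coordinate directions of `ℝ^d × ℝ^d`. -/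
def dirXK (d : ℕ) : Fin d ⊕ Fin d → EuclideanSpace ℝ (Fin d) × EuclideanSpace ℝ (Fin d) :=
  Sum.elim (dirX d) (dirK d)

instance Sum.instLawfulBEq {α β : Type*} [BEq α] [BEq β] [LawfulBEq α] [LawfulBEq β] :
    LawfulBEq (α ⊕ β) where
  rfl {a} := match a with
    | .inl a => beq_self_eq_true a
    | .inr a => beq_self_eq_true a
  eq_of_beq {a b} h := by
    cases a <;> cases b <;> first | exact congrArg _ (eq_of_beq h) | cases h

/-- The word whose `wordDeriv` is `Dmix`. -/
def mixWord {d : ℕ} (α β : Fin d → ℕ) : List (Fin d ⊕ Fin d) :=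
  (indexWord β).map Sum.inr ++ (indexWord α).map Sum.inl

lemma Dmix_eq_wordDeriv {d : ℕ} (α β : Fin d → ℕ)
    (f : EuclideanSpace ℝ (Fin d) × EuclideanSpace ℝ (Fin d) → ℂ) :
    Dmix d α β f = wordDeriv (dirXK d) (mixWord α β) f := by
  rw [Dmix, pmulti_eq_wordDeriv, pmulti_eq_wordDeriv, mixWord, wordDeriv_append, wordDeriv_map,
    wordDeriv_map]
  rfl

lemma count_inr_mixWord {d : ℕ} (α β : Fin d → ℕ) (j : Fin d) :
    (mixWord α β).count (Sum.inr j) = β j := by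
  rw [mixWord, List.count_append, List.count_map_of_injective _ _ Sum.inr_injective,
    count_indexWord, List.count_eq_zero_of_not_mem (by simp), add_zero]

lemma count_inl_mixWord {d : ℕ} (α β : Fin d → ℕ) (j : Fin d) :
    (mixWord α β).count (Sum.inl j) = α j := by
  rw [mixWord, List.count_append, List.count_map_of_injective _ _ Sum.inl_injective,
    count_indexWord, List.count_eq_zero_of_not_mem (by simp), zero_add]

lemma wordDeriv_eq_Dmix {d : ℕ} (L : List (Fin d ⊕ Fin d))
    {f : EuclideanSpace ℝ (Fin d) × EuclideanSpace ℝ (Fin d) → ℂ}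
    {U : Set (EuclideanSpace ℝ (Fin d) × EuclideanSpace ℝ (Fin d))} (hU : IsOpen U)
    (hf : ContDiffOn ℝ (⊤ : ℕ∞) f U) :
    Set.EqOn (wordDeriv (dirXK d) L f)
      (Dmix d (fun j => L.count (Sum.inl j)) (fun j => L.count (Sum.inr j)) f) U := by
  rw [Dmix_eq_wordDeriv]
  refine wordDeriv_perm (List.perm_iff_count.2 ?_) hU hf _
  rintro (j | j)
  · rw [count_inl_mixWord]
  · rw [count_inr_mixWord]

/-- The phase space `ℝ^d × ℝ^d`. -/
abbrev Phase (d : ℕ) := EuclideanSpace ℝ (Fin d) × EuclideanSpace ℝ (Fin d)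

section Series

variable {d : ℕ}

/-- The coordinates of a point of phase space with respect to `dirXK`. -/
def coordXK : Fin d ⊕ Fin d → Phase d → ℝ :=
  Sum.elim (fun j y => y.1 j) (fun j y => y.2 j)

lemma abs_coordXK_le (i : Fin d ⊕ Fin d) (y : Phase d) : |coordXK i y| ≤ ‖y‖ := by
  rcases i with j | j
  · exact (PiLp.norm_apply_le y.1 j).trans (norm_fst_le y)
  · exact (PiLp.norm_apply_le y.2 j).trans (norm_snd_le y)

lemma EuclideanSpace.sum_smul_single (x : EuclideanSpace ℝ (Fin d)) :
    ∑ j, x j • EuclideanSpace.single j (1 : ℝ) = x := by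
  ext i
  simp [Finset.sum_apply, Pi.single_apply]

lemma sum_coordXK_smul (y : Phase d) : ∑ i, coordXK i y • dirXK d i = y := by
  rw [Fintype.sum_sum_type]
  refine Prod.ext ?_ ?_
  · simpa [coordXK, dirXK, dirX, dirK, Prod.fst_sum] using EuclideanSpace.sum_smul_single y.1
  · simpa [coordXK, dirXK, dirX, dirK, Prod.snd_sum] using EuclideanSpace.sum_smul_single y.2

lemma clm_apply_eq_sum (A : Phase d →L[ℝ] ℂ) (y : Phase d) :
    A y = ∑ i, coordXK i y • A (dirXK d i) := by
  conv_lhs => rw [← sum_coordXK_smul y]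
  simp

lemma clm_norm_le_sum (A : Phase d →L[ℝ] ℂ) : ‖A‖ ≤ ∑ i, ‖A (dirXK d i)‖ := by
  refine A.opNorm_le_bound (Finset.sum_nonneg fun _ _ => norm_nonneg _) fun y => ?_
  rw [clm_apply_eq_sum, Finset.sum_mul]
  refine norm_sum_le_of_le _ fun i _ => ?_
  rw [norm_smul, mul_comm]
  exact mul_le_mul_of_nonneg_left (abs_coordXK_le i y) (norm_nonneg _)

/-- A sequence of smooth functions all of whose coordinate derivatives are summable, locally
uniformly in `k` and uniformly in `x`. -/
structure SummableDeriv (u : ℕ → Phase d → ℂ) : Prop where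
  smooth : ∀ n, ContDiff ℝ (⊤ : ℕ∞) (u n)
  bound : ∀ (L : List (Fin d ⊕ Fin d)) (R : ℝ), ∃ v : ℕ → ℝ, Summable v ∧
    ∀ n p, ‖p.2‖ < R → ‖wordDeriv (dirXK d) L (u n) p‖ ≤ v n

namespace SummableDeriv

variable {u : ℕ → Phase d → ℂ}

lemma pdir (hu : SummableDeriv u) (i : Fin d ⊕ Fin d) :
    SummableDeriv fun n => pdir (dirXK d i) (u n) where
  smooth n := (hu.smooth n).pdir _
  bound L R := hu.bound (i :: L) R

lemma summable (hu : SummableDeriv u) (p : Phase d) : Summable fun n => u n p := by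
  obtain ⟨v, hv, h⟩ := hu.bound [] (‖p.2‖ + 1)
  exact hv.of_norm_bounded fun n => h n p (lt_add_one _)

lemma exists_fderiv_bound (hu : SummableDeriv u) (R : ℝ) : ∃ v : ℕ → ℝ, Summable v ∧
    ∀ n p, ‖p.2‖ < R → ‖fderiv ℝ (u n) p‖ ≤ v n := by
  choose v hv h using fun i => hu.bound [i] R
  exact ⟨fun n => ∑ i, v i n, summable_sum fun i _ => hv i, fun n p hp =>
    (clm_norm_le_sum _).trans (Finset.sum_le_sum fun i _ => h i n p hp)⟩

lemma hasFDerivAt_tsum (hu : SummableDeriv u) (p : Phase d) :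
    HasFDerivAt (fun q => ∑' n, u n q) (∑' n, fderiv ℝ (u n) p) p := by
  obtain ⟨v, hv, h⟩ := hu.exists_fderiv_bound (‖p.2‖ + 1)
  have hs : {q : Phase d | ‖q.2‖ < ‖p.2‖ + 1} =
      Set.univ ×ˢ Metric.ball (0 : EuclideanSpace ℝ (Fin d)) (‖p.2‖ + 1) := by
    ext q; simp
  refine hasFDerivAt_tsum_of_isPreconnected (s := {q : Phase d | ‖q.2‖ < ‖p.2‖ + 1})
    (f' := fun n q => fderiv ℝ (u n) q) (x₀ := p) hv ?_ ?_
    (fun n q _ => ((hu.smooth n).differentiable (by simp) q).hasFDerivAt) (fun n q hq => h n q hq)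
    (lt_add_one ‖p.2‖) (hu.summable p) (lt_add_one ‖p.2‖)
  · rw [hs]; exact isOpen_univ.prod Metric.isOpen_ball
  · rw [hs]; exact isPreconnected_univ.prod (convex_ball _ _).isPreconnected

lemma pdir_tsum (hu : SummableDeriv u) (i : Fin d ⊕ Fin d) :
    _root_.pdir (dirXK d i) (fun q => ∑' n, u n q) =
      fun q => ∑' n, _root_.pdir (dirXK d i) (u n) q := by
  ext p
  obtain ⟨v, hv, h⟩ := hu.exists_fderiv_bound (‖p.2‖ + 1)
  have hsum : Summable fun n => fderiv ℝ (u n) p :=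
    hv.of_norm_bounded fun n => h n p (lt_add_one _)
  rw [_root_.pdir, (hu.hasFDerivAt_tsum p).fderiv]
  exact (ContinuousLinearMap.apply ℝ ℂ (dirXK d i)).map_tsum hsum

lemma wordDeriv_tsum (hu : SummableDeriv u) (L : List (Fin d ⊕ Fin d)) :
    wordDeriv (dirXK d) L (fun q => ∑' n, u n q) =
      fun q => ∑' n, wordDeriv (dirXK d) L (u n) q := by
  induction L generalizing u with
  | nil => rfl
  | cons i L ih => simp only [wordDeriv_cons, hu.pdir_tsum i, ih (hu.pdir i)]

lemma contDiff_tsum (hu : SummableDeriv u) :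
    ContDiff ℝ (⊤ : ℕ∞) (fun q => ∑' n, u n q) := by
  refine contDiff_infty.2 fun m => ?_
  induction m generalizing u with
  | zero =>
    exact contDiff_zero.2
      (continuous_iff_continuousAt.2 fun p => (hu.hasFDerivAt_tsum p).continuousAt)
  | succ m ih =>
    refine (contDiff_succ_iff_fderiv (n := (m : WithTop ℕ∞))).2
      ⟨fun p => (hu.hasFDerivAt_tsum p).differentiableAt, by simp, ?_⟩
    refine contDiff_clm_apply_iff.2 fun y => ?_
    simp_rw [clm_apply_eq_sum (fderiv ℝ _ _) y]
    refine ContDiff.sum fun i _ => ContDiff.const_smul _ ?_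
    have := hu.pdir_tsum i
    unfold _root_.pdir at this
    rw [this]
    exact ih (hu.pdir i)

end SummableDeriv

end Series

section Extrapolation

lemma sum_alternating_choose_mul_pow {m i : ℕ} (hi : i < m) (t a : ℝ) :
    ∑ j ∈ Finset.range m, ((-1) ^ j * (m.choose (j + 1) : ℝ)) * (1 - (j + 1) * t - a) ^ i =
      (1 - a) ^ i := by
  set P : Polynomial ℝ := (Polynomial.C (1 - a) - Polynomial.C t * Polynomial.X) ^ i with hP
  have hdeg : P.natDegree < m := by
    have h1 : (Polynomial.C (1 - a) - Polynomial.C t * Polynomial.X).natDegree ≤ 1 := by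
      compute_degree
    exact (Polynomial.natDegree_pow_le.trans (Nat.mul_le_mul_left i h1)).trans_lt
      (by simpa using hi)
  have h0 := congrFun (Polynomial.fwdDiff_iter_eq_zero_of_degree_lt hdeg) 0
  rw [fwdDiff_iter_eq_sum_shift] at h0
  have h1 :
      ∑ k ∈ Finset.range (m + 1), ((-1) ^ k * (m.choose k : ℝ)) * (1 - k * t - a) ^ i = 0 := by
    have h2 : (-1 : ℝ) ^ m * ∑ k ∈ Finset.range (m + 1),
        ((-1) ^ k * (m.choose k : ℝ)) * (1 - k * t - a) ^ i = 0 := by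
      rw [Pi.zero_apply] at h0
      rw [← h0, Finset.mul_sum]
      refine Finset.sum_congr rfl fun k hk => ?_
      have hkm : k ≤ m := Nat.lt_succ_iff.1 (Finset.mem_range.1 hk)
      have hs : (-1 : ℝ) ^ m * (-1) ^ k = (-1) ^ (m - k) := by
        obtain ⟨l, rfl⟩ := Nat.exists_eq_add_of_le hkm
        rw [Nat.add_sub_cancel_left, pow_add, mul_right_comm, ← mul_pow]
        simp
      have he : Polynomial.eval (0 + k • (1 : ℝ)) P = (1 - k * t - a) ^ i := by
        simp [hP]; ring
      rw [he, ← mul_assoc, ← mul_assoc, hs]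
      simp
    exact (mul_eq_zero.1 h2).resolve_left (pow_ne_zero _ (by norm_num))
  rw [Finset.sum_range_succ'] at h1
  have h3 : ∑ j ∈ Finset.range m, ((-1) ^ j * (m.choose (j + 1) : ℝ)) * (1 - (j + 1) * t - a) ^ i =
      -∑ j ∈ Finset.range m,
        ((-1) ^ (j + 1) * (m.choose (j + 1) : ℝ)) * (1 - ((j + 1 : ℕ) : ℝ) * t - a) ^ i := by
    rw [← Finset.sum_neg_distrib]
    refine Finset.sum_congr rfl fun j _ => ?_
    push_cast
    ring
  rw [h3, eq_neg_of_add_eq_zero_left h1]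
  simp

/-- Extrapolation to `1` of order `m` from the nodes `1 - (j+1) 4⁻ᵐ`. -/
def extrap (m : ℕ) (h : ℝ → ℂ) : ℂ :=
  ∑ j ∈ Finset.range m, ((-1) ^ j * (m.choose (j + 1) : ℝ)) • h (1 - (j + 1) * (1 / 4) ^ m)

/-- The weights of the functional `extrap (n + 1) - extrap n`. -/
def extrapCoef (n : ℕ) : Fin (n + 1) ⊕ Fin n → ℝ :=
  Sum.elim (fun j => (-1) ^ (j : ℕ) * ((n + 1).choose (j + 1) : ℝ))
    (fun j => -((-1) ^ (j : ℕ) * (n.choose (j + 1) : ℝ)))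

/-- The nodes of the functional `extrap (n + 1) - extrap n`. -/
def extrapNode (n : ℕ) : Fin (n + 1) ⊕ Fin n → ℝ :=
  Sum.elim (fun j => 1 - ((j : ℕ) + 1) * (1 / 4) ^ (n + 1))
    (fun j => 1 - ((j : ℕ) + 1) * (1 / 4) ^ n)

lemma sum_extrapCoef_smul (n : ℕ) (h : ℝ → ℂ) :
    ∑ j, extrapCoef n j • h (extrapNode n j) = extrap (n + 1) h - extrap n h := by
  rw [Fintype.sum_sum_type, sub_eq_add_neg]
  simp only [extrapCoef, extrapNode, Sum.elim_inl, Sum.elim_inr, extrap, neg_smul,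
    Finset.sum_neg_distrib]
  rw [Finset.sum_range, Finset.sum_range]

lemma sum_extrapCoef_mul_pow {n i : ℕ} (hi : i < n) (a : ℝ) :
    ∑ j, extrapCoef n j * (extrapNode n j - a) ^ i = 0 := by
  have h1 := sum_alternating_choose_mul_pow (m := n + 1) (hi.trans n.lt_succ_self)
    ((1 / 4) ^ (n + 1)) a
  have h2 := sum_alternating_choose_mul_pow hi ((1 / 4) ^ n) a
  rw [Finset.sum_range] at h1 h2
  rw [Fintype.sum_sum_type]
  simp only [extrapCoef, extrapNode, Sum.elim_inl, Sum.elim_inr, neg_mul,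
    Finset.sum_neg_distrib]
  rw [h1, h2, add_neg_cancel]

lemma sum_choose_succ_le (m : ℕ) : ∑ j : Fin m, (m.choose (j + 1) : ℝ) ≤ 2 ^ m := by
  have h := Nat.sum_range_choose m
  rw [Finset.sum_range_succ', Finset.sum_range] at h
  have : (∑ j : Fin m, m.choose (j + 1)) ≤ 2 ^ m := by omega
  exact_mod_cast this

lemma sum_abs_extrapCoef_le (n : ℕ) : ∑ j, |extrapCoef n j| ≤ 2 ^ (n + 2) := by
  rw [Fintype.sum_sum_type]
  simp only [extrapCoef, Sum.elim_inl, Sum.elim_inr, abs_neg, abs_mul, abs_pow, abs_one, one_pow,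
    one_mul, Nat.abs_cast]
  have h1 := sum_choose_succ_le (n + 1)
  have h2 := sum_choose_succ_le n
  have h3 : (0 : ℝ) < 2 ^ n := by positivity
  rw [pow_succ] at h1 ⊢
  rw [pow_succ]
  linarith

lemma extrapNode_mem (n : ℕ) (j : Fin (n + 1) ⊕ Fin n) :
    extrapNode n j ∈ Set.Icc (max (3 / 4) (1 - (n + 1) * (1 / 4 : ℝ) ^ n))
      (1 - (1 / 4 : ℝ) ^ (n + 1)) := by
  have hpow : (0 : ℝ) < (1 / 4) ^ n := by positivity
  have hq : ∀ m : ℕ, (m : ℝ) * (1 / 4) ^ m ≤ 1 / 4 := by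
    intro m
    induction m with
    | zero => norm_num
    | succ m ih =>
      rcases Nat.eq_zero_or_pos m with rfl | hm
      · norm_num
      · have : (1 : ℝ) ≤ m := by exact_mod_cast hm
        have hp : (0 : ℝ) < (1 / 4) ^ m := by positivity
        rw [pow_succ]
        push_cast
        nlinarith
  rcases j with j | j
  · have hj : ((j : ℕ) : ℝ) + 1 ≤ n + 1 := by exact_mod_cast j.2
    have hj0 : (0 : ℝ) ≤ ((j : ℕ) : ℝ) := by positivity
    have h4 := hq (n + 1)
    simp only [extrapNode, Sum.elim_inl, Set.mem_Icc, max_le_iff]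
    push_cast at h4
    rw [pow_succ] at h4 ⊢
    refine ⟨⟨?_, ?_⟩, ?_⟩ <;> nlinarith
  · have hj : ((j : ℕ) : ℝ) + 1 ≤ n := by exact_mod_cast j.2
    have hj0 : (0 : ℝ) ≤ ((j : ℕ) : ℝ) := by positivity
    have h4 := hq n
    simp only [extrapNode, Sum.elim_inr, Set.mem_Icc, max_le_iff]
    rw [pow_succ]
    refine ⟨⟨?_, ?_⟩, ?_⟩ <;> nlinarith

/-- A polynomial approximation of the derivative integrates to one of the function. -/
lemma exists_poly_approx_of_deriv {h h' : ℝ → ℂ} {a b M : ℝ} (hab : a ≤ b) {N : ℕ}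
    (hd : ∀ s ∈ Set.Icc a b, HasDerivAt h (h' s) s)
    (hA : ∃ q : ℕ → ℂ, ∀ s ∈ Set.Icc a b,
      ‖h' s - ∑ i ∈ Finset.range N, (s - a) ^ i • q i‖ ≤ M) :
    ∃ q : ℕ → ℂ, ∀ s ∈ Set.Icc a b,
      ‖h s - ∑ i ∈ Finset.range (N + 1), (s - a) ^ i • q i‖ ≤ M * (b - a) := by
  obtain ⟨q, hq⟩ := hA
  set q' : ℕ → ℂ := fun i => Nat.casesOn i (h a) fun i => ((i : ℝ) + 1)⁻¹ • q i with hq'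
  refine ⟨q', fun s hs => ?_⟩
  have ha : a ∈ Set.Icc a b := ⟨le_rfl, hab⟩
  have hM : 0 ≤ M := (norm_nonneg _).trans (hq a ha)
  set F : ℝ → ℂ := fun s => h s - ∑ i ∈ Finset.range N, (s - a) ^ (i + 1) • q' (i + 1) with hF
  have hF' : ∀ s ∈ Set.Icc a b,
      HasDerivWithinAt F (h' s - ∑ i ∈ Finset.range N, (s - a) ^ i • q i) (Set.Icc a b) s := by
    intro s hs
    refine HasDerivAt.hasDerivWithinAt ((hd s hs).fun_sub (HasDerivAt.fun_sum fun i _ => ?_))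
    have h1 := ((((hasDerivAt_id s).sub_const a).fun_pow (i + 1)).smul_const (q' (i + 1)))
    convert! h1 using 1
    simp only [hq', smul_smul]
    congr 1
    simp
    field_simp
  have hle := Convex.norm_image_sub_le_of_norm_hasDerivWithin_le hF' hq (convex_Icc a b) ha hs
  have hFa : F a = h a := by simp [hF]
  rw [hFa] at hle
  have : h s - ∑ i ∈ Finset.range (N + 1), (s - a) ^ i • q' i = F s - h a := by
    rw [Finset.sum_range_succ']
    simp [hF, hq']
    ring
  rw [this]
  refine hle.trans (mul_le_mul_of_nonneg_left ?_ hM)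
  rw [Real.norm_of_nonneg (sub_nonneg.2 hs.1)]
  linarith [hs.2]

lemma norm_sum_smul_le_of_poly_approx {J : Type*} [Fintype J] {c t : J → ℝ} {h : ℝ → ℂ}
    {a b M : ℝ} {N : ℕ} (ht : ∀ j, t j ∈ Set.Icc a b)
    (hc : ∀ i < N, ∑ j, c j * (t j - a) ^ i = 0) {q : ℕ → ℂ}
    (hq : ∀ s ∈ Set.Icc a b, ‖h s - ∑ i ∈ Finset.range N, (s - a) ^ i • q i‖ ≤ M) :
    ‖∑ j, c j • h (t j)‖ ≤ (∑ j, |c j|) * M := by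
  have h0 : ∑ j, c j • ∑ i ∈ Finset.range N, (t j - a) ^ i • q i = 0 := by
    simp_rw [Finset.smul_sum, smul_smul]
    rw [Finset.sum_comm]
    refine Finset.sum_eq_zero fun i hi => ?_
    rw [← Finset.sum_smul, hc i (Finset.mem_range.1 hi), zero_smul]
  have h1 : ∑ j, c j • h (t j) =
      ∑ j, c j • (h (t j) - ∑ i ∈ Finset.range N, (t j - a) ^ i • q i) := by
    simp_rw [smul_sub]
    rw [Finset.sum_sub_distrib, h0, sub_zero]
  rw [h1, Finset.sum_mul]
  refine norm_sum_le_of_le _ fun j _ => ?_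
  rw [norm_smul, Real.norm_eq_abs]
  exact mul_le_mul_of_nonneg_left (hq _ (ht j)) (abs_nonneg _)

/-- Extrapolation converges for functions differentiable at `1`. -/
lemma tendsto_extrap {h : ℝ → ℂ} (hd : DifferentiableAt ℝ h 1) :
    Filter.Tendsto (fun m => extrap m h) Filter.atTop (nhds (h 1)) := by
  obtain ⟨K, hK⟩ := hd.isBigO_sub.bound
  obtain ⟨η, hη, hball⟩ := Metric.eventually_nhds_iff.1 hK
  have hlim : Filter.Tendsto (fun m : ℕ => (m : ℝ) * (1 / 4) ^ m) Filter.atTop (nhds 0) :=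
    tendsto_self_mul_const_pow_of_lt_one (by norm_num) (by norm_num)
  have hlim2 : Filter.Tendsto (fun m : ℕ => |K| * ((m : ℝ) * (1 / 2) ^ m))
      Filter.atTop (nhds 0) := by
    simpa using (tendsto_self_mul_const_pow_of_lt_one (r := (1 / 2 : ℝ)) (by norm_num)
      (by norm_num)).const_mul |K|
  rw [tendsto_iff_norm_sub_tendsto_zero]
  refine squeeze_zero' (Filter.Eventually.of_forall fun _ => norm_nonneg _) ?_ hlim2
  filter_upwards [hlim.eventually (gt_mem_nhds hη), Filter.eventually_gt_atTop 0] with m hm hm0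
  have hsum := sum_alternating_choose_mul_pow hm0 ((1 / 4) ^ m) 0
  simp only [pow_zero, mul_one] at hsum
  have heq : extrap m h - h 1 = ∑ j ∈ Finset.range m, ((-1) ^ j * (m.choose (j + 1) : ℝ)) •
      (h (1 - (j + 1) * (1 / 4) ^ m) - h 1) := by
    simp_rw [smul_sub]
    rw [Finset.sum_sub_distrib, ← Finset.sum_smul, hsum, one_smul, extrap]
  have hbound : ‖extrap m h - h 1‖ ≤
      ∑ j ∈ Finset.range m, (m.choose (j + 1) : ℝ) * (|K| * (m * (1 / 4) ^ m)) := by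
    rw [heq]
    refine norm_sum_le_of_le _ fun j hj => ?_
    have hj' : (j : ℝ) + 1 ≤ m := by exact_mod_cast Finset.mem_range.1 hj
    have hpos : (0 : ℝ) < (1 / 4) ^ m := by positivity
    have hle : ((j : ℝ) + 1) * (1 / 4) ^ m ≤ m * (1 / 4) ^ m := by gcongr
    have habs : ‖(1 - ((j : ℝ) + 1) * (1 / 4) ^ m) - 1‖ = ((j : ℝ) + 1) * (1 / 4) ^ m := by
      rw [sub_sub_cancel_left, norm_neg, Real.norm_of_nonneg (by positivity)]
    have hb := hball (y := 1 - ((j : ℝ) + 1) * (1 / 4) ^ m)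
      (by rw [dist_eq_norm, habs]; exact hle.trans_lt hm)
    rw [norm_smul, norm_mul, norm_pow, norm_neg, norm_one, one_pow, one_mul,
      Real.norm_of_nonneg (by positivity)]
    refine mul_le_mul_of_nonneg_left (hb.trans ?_) (by positivity)
    rw [habs]
    exact mul_le_mul (le_abs_self K) hle (by positivity) (abs_nonneg _)
  refine hbound.trans ?_
  rw [← Finset.sum_mul, Finset.sum_range]
  calc (∑ j : Fin m, (m.choose (j + 1) : ℝ)) * (|K| * (m * (1 / 4) ^ m))
      ≤ 2 ^ m * (|K| * (m * (1 / 4) ^ m)) := by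
        gcongr
        exact sum_choose_succ_le m
    _ = |K| * (m * (1 / 2) ^ m) := by
        have : (1 / 2 : ℝ) ^ m = 2 ^ m * (1 / 4) ^ m := by rw [← mul_pow]; norm_num
        rw [this]; ring

end Extrapolation

section Dilation

variable {d : ℕ} {J : Type*} [Fintype J]

/-- The domain `B × ℝ^d`. -/
abbrev ballPhase (d : ℕ) : Set (Phase d) :=
  Metric.ball (0 : EuclideanSpace ℝ (Fin d)) 1 ×ˢ Set.univ

lemma isOpen_ballPhase : IsOpen (ballPhase d) := Metric.isOpen_ball.prod isOpen_univ

/-- Dilation in the position variable. -/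
def dilation (d : ℕ) (s : ℝ) : Phase d →L[ℝ] Phase d :=
  (s • ContinuousLinearMap.fst ℝ _ _).prod (ContinuousLinearMap.snd ℝ _ _)

lemma dilation_apply (s : ℝ) (p : Phase d) : dilation d s p = (s • p.1, p.2) := rfl

/-- A weighted sum of dilations of `g` in the position variable, cut off by `χ`. -/
def dilSum (c t : J → ℝ) (χ : EuclideanSpace ℝ (Fin d) → ℝ) (r : ℕ) (g : Phase d → ℂ) :
    Phase d → ℂ :=
  fun p => χ p.1 • ∑ j, c j • (t j ^ r • g (dilation d (t j) p))

variable {c t : J → ℝ} {χ : EuclideanSpace ℝ (Fin d) → ℝ} {g : Phase d → ℂ}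

lemma dilSum_eventuallyEq_zero {p : Phase d} (hp : p.1 ∉ tsupport χ) (r : ℕ) :
    dilSum c t χ r g =ᶠ[nhds p] 0 := by
  have h := (notMem_tsupport_iff_eventuallyEq.1 hp)
  filter_upwards [continuous_fst.continuousAt.eventually h] with q hq
  simp [dilSum, hq]

lemma contDiff_dilSum (hχ : ContDiff ℝ (⊤ : ℕ∞) χ)
    (ht : ∀ x ∈ tsupport χ, ∀ j, t j • x ∈ Metric.ball (0 : EuclideanSpace ℝ (Fin d)) 1)
    (hg : ContDiffOn ℝ (⊤ : ℕ∞) g (ballPhase d)) (r : ℕ) :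
    ContDiff ℝ (⊤ : ℕ∞) (dilSum c t χ r g) := by
  refine contDiff_iff_contDiffAt.2 fun p => ?_
  by_cases hp : p.1 ∈ tsupport χ
  · refine (hχ.comp contDiff_fst).contDiffAt.smul (ContDiffAt.sum fun j _ => ?_)
    refine ContDiffAt.const_smul _ (ContDiffAt.const_smul _ ?_)
    have hgj : ContDiffAt ℝ (⊤ : ℕ∞) g (dilation d (t j) p) :=
      hg.contDiffAt (isOpen_ballPhase.mem_nhds ⟨ht _ hp j, trivial⟩)
    exact hgj.comp p (dilation d (t j)).contDiff.contDiffAt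
  · exact contDiffAt_const.congr_of_eventuallyEq (dilSum_eventuallyEq_zero hp r)

lemma fderiv_dilSum_apply (hχ : ContDiff ℝ (⊤ : ℕ∞) χ)
    (ht : ∀ x ∈ tsupport χ, ∀ j, t j • x ∈ Metric.ball (0 : EuclideanSpace ℝ (Fin d)) 1)
    (hg : ContDiffOn ℝ (⊤ : ℕ∞) g (ballPhase d)) (r : ℕ) (p y : Phase d) :
    fderiv ℝ (dilSum c t χ r g) p y =
      fderiv ℝ χ p.1 y.1 • (∑ j, c j • (t j ^ r • g (dilation d (t j) p))) +
      χ p.1 • ∑ j, c j • (t j ^ r • fderiv ℝ g (dilation d (t j) p) (dilation d (t j) y)) := by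
  by_cases hp : p.1 ∈ tsupport χ
  · have h1 : HasFDerivAt (fun q : Phase d => χ q.1)
        ((fderiv ℝ χ p.1).comp (ContinuousLinearMap.fst ℝ _ _)) p :=
      (hχ.differentiable (by simp) p.1).hasFDerivAt.comp p hasFDerivAt_fst
    have h2 : HasFDerivAt (fun q : Phase d => ∑ j, c j • (t j ^ r • g (dilation d (t j) q)))
        (∑ j, c j • (t j ^ r • (fderiv ℝ g (dilation d (t j) p)).comp (dilation d (t j)))) p := by
      refine HasFDerivAt.fun_sum fun j _ =>
        HasFDerivAt.fun_const_smul (HasFDerivAt.fun_const_smul ?_ _) _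
      have hgj : ContDiffAt ℝ (⊤ : ℕ∞) g (dilation d (t j) p) :=
        hg.contDiffAt (isOpen_ballPhase.mem_nhds ⟨ht _ hp j, trivial⟩)
      exact (hgj.differentiableAt (by simp)).hasFDerivAt.comp p (dilation d (t j)).hasFDerivAt
    have h3 : HasFDerivAt (dilSum c t χ r g) _ p := h1.smul h2
    rw [h3.fderiv, add_comm]
    simp
  · have hp' : p.1 ∉ tsupport (fun x => fderiv ℝ χ x y.1) := fun h =>
      hp (tsupport_fderiv_apply_subset ℝ y.1 h)
    rw [(dilSum_eventuallyEq_zero hp r).fderiv_eq, image_eq_zero_of_notMem_tsupport hp,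
      image_eq_zero_of_notMem_tsupport hp']
    simp

lemma pdir_inl_dilSum (hχ : ContDiff ℝ (⊤ : ℕ∞) χ)
    (ht : ∀ x ∈ tsupport χ, ∀ j, t j • x ∈ Metric.ball (0 : EuclideanSpace ℝ (Fin d)) 1)
    (hg : ContDiffOn ℝ (⊤ : ℕ∞) g (ballPhase d)) (r : ℕ) (i : Fin d) :
    pdir (dirXK d (Sum.inl i)) (dilSum c t χ r g) =
      dilSum c t (pdir (EuclideanSpace.single i 1) χ) r g +
      dilSum c t χ (r + 1) (pdir (dirXK d (Sum.inl i)) g) := by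
  ext p
  have : ∀ s, dilation d s (dirXK d (Sum.inl i)) = s • dirXK d (Sum.inl i) := fun s => by
    simp [dilation_apply, dirXK, dirX]
  rw [pdir, fderiv_dilSum_apply hχ ht hg]
  simp only [this, map_smul, smul_smul, pdir, dilSum, Pi.add_apply, pow_succ]
  rfl

lemma pdir_inr_dilSum (hχ : ContDiff ℝ (⊤ : ℕ∞) χ)
    (ht : ∀ x ∈ tsupport χ, ∀ j, t j • x ∈ Metric.ball (0 : EuclideanSpace ℝ (Fin d)) 1)
    (hg : ContDiffOn ℝ (⊤ : ℕ∞) g (ballPhase d)) (r : ℕ) (i : Fin d) :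
    pdir (dirXK d (Sum.inr i)) (dilSum c t χ r g) =
      dilSum c t χ r (pdir (dirXK d (Sum.inr i)) g) := by
  ext p
  have : ∀ s, dilation d s (dirXK d (Sum.inr i)) = dirXK d (Sum.inr i) := fun s => by
    simp [dilation_apply, dirXK, dirK]
  rw [pdir, fderiv_dilSum_apply hχ ht hg]
  simp only [this, pdir, dilSum]
  simp [dirXK, dirK]

/-- Along a ray, a function with bounded position derivatives is close to a polynomial. -/
lemma exists_poly_approx_ray (N r : ℕ) : ∃ C : ℝ, 0 ≤ C ∧ ∀ g : Phase d → ℂ,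
    ContDiffOn ℝ (⊤ : ℕ∞) g (ballPhase d) → ∀ (x k : EuclideanSpace ℝ (Fin d)) (a b M : ℝ),
    0 ≤ a → a ≤ b → b ≤ 1 → b * ‖x‖ < 1 → ‖x‖ ≤ 2 →
    (∀ L : List (Fin d), L.length ≤ N → ∀ z ∈ Metric.ball (0 : EuclideanSpace ℝ (Fin d)) 1,
      ‖wordDeriv (dirXK d) (L.map Sum.inl) g (z, k)‖ ≤ M) →
    ∃ q : ℕ → ℂ, ∀ s ∈ Set.Icc a b,
      ‖s ^ r • g (dilation d s (x, k)) - ∑ i ∈ Finset.range N, (s - a) ^ i • q i‖ ≤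
        C * M * (b - a) ^ N := by
  have hball : ∀ {x : EuclideanSpace ℝ (Fin d)} {a b s : ℝ}, 0 ≤ a → b * ‖x‖ < 1 →
      s ∈ Set.Icc a b → s • x ∈ Metric.ball (0 : EuclideanSpace ℝ (Fin d)) 1 := by
    intro x a b s ha hbx hs
    rw [mem_ball_zero_iff, norm_smul, Real.norm_of_nonneg (ha.trans hs.1)]
    exact (mul_le_mul_of_nonneg_right hs.2 (norm_nonneg x)).trans_lt hbx
  induction N generalizing r with
  | zero =>
    refine ⟨1, zero_le_one, fun g hg x k a b M ha hab hb hbx hx hM => ⟨0, fun s hs => ?_⟩⟩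
    have hs0 : 0 ≤ s := ha.trans hs.1
    have h1 := hM [] le_rfl _ (hball ha hbx hs)
    rw [List.map_nil, wordDeriv_nil] at h1
    rw [Finset.range_zero, Finset.sum_empty, sub_zero, norm_smul, norm_pow,
      Real.norm_of_nonneg hs0, one_mul, pow_zero, mul_one]
    calc s ^ r * ‖g (s • x, k)‖ ≤ 1 * ‖g (s • x, k)‖ := by
          gcongr
          exact pow_le_one₀ hs0 (hs.2.trans hb)
      _ ≤ M := by rwa [one_mul]
  | succ N ih =>
    obtain ⟨C₁, hC₁, h₁⟩ := ih (r - 1)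
    obtain ⟨C₂, hC₂, h₂⟩ := ih r
    refine ⟨r * C₁ + ∑ _i : Fin d, 2 * C₂, by positivity,
      fun g hg x k a b M ha hab hb hbx hx hM => ?_⟩
    have hd : ∀ s ∈ Set.Icc a b, HasDerivAt (fun s => s ^ r • g (dilation d s (x, k)))
        ((r : ℝ) • (s ^ (r - 1) • g (dilation d s (x, k))) +
          ∑ i, x i • (s ^ r • pdir (dirXK d (Sum.inl i)) g (dilation d s (x, k)))) s := by
      intro s hs
      have hgs : ContDiffAt ℝ (⊤ : ℕ∞) g (dilation d s (x, k)) :=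
        hg.contDiffAt (isOpen_ballPhase.mem_nhds ⟨hball ha hbx hs, trivial⟩)
      have hray : HasDerivAt (fun s => dilation d s (x, k)) (x, (0 : EuclideanSpace ℝ (Fin d))) s := by
        have := ((hasDerivAt_id s).smul_const x).prodMk (hasDerivAt_const s k)
        simpa [dilation_apply] using this
      have h3 := (hgs.differentiableAt (by simp)).hasFDerivAt.comp_hasDerivAt s hray
      have h4 := (hasDerivAt_pow r s).fun_smul h3
      convert! h4 using 1
      rw [add_comm, clm_apply_eq_sum _ (x, (0 : EuclideanSpace ℝ (Fin d))), Fintype.sum_sum_type]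
      simp [coordXK, pdir, Finset.mul_sum, mul_assoc, mul_left_comm]
    obtain ⟨q₁, hq₁⟩ := h₁ g hg x k a b M ha hab hb hbx hx fun L hL => hM L (hL.trans N.le_succ)
    have h5 : ∀ i : Fin d, ∃ q : ℕ → ℂ, ∀ s ∈ Set.Icc a b,
        ‖s ^ r • pdir (dirXK d (Sum.inl i)) g (dilation d s (x, k)) -
          ∑ l ∈ Finset.range N, (s - a) ^ l • q l‖ ≤ C₂ * M * (b - a) ^ N := fun i =>
      h₂ _ (hg.pdir isOpen_ballPhase _) x k a b M ha hab hb hbx hx fun L hL =>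
        hM (i :: L) (Nat.succ_le_succ hL)
    choose q₂ hq₂ using h5
    obtain ⟨q, hq⟩ := exists_poly_approx_of_deriv (N := N)
      (M := (r * C₁ + ∑ _i : Fin d, 2 * C₂) * M * (b - a) ^ N) hab hd
      ⟨fun l => (r : ℝ) • q₁ l + ∑ i, x i • q₂ i l, fun s hs => by
        have hsum : ∑ l ∈ Finset.range N, (s - a) ^ l • ((r : ℝ) • q₁ l + ∑ i, x i • q₂ i l) =
            (r : ℝ) • (∑ l ∈ Finset.range N, (s - a) ^ l • q₁ l) +
            ∑ i, x i • (∑ l ∈ Finset.range N, (s - a) ^ l • q₂ i l) := by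
          simp_rw [smul_add, Finset.sum_add_distrib, Finset.smul_sum]
          rw [Finset.sum_comm (s := Finset.range N)]
          simp_rw [smul_comm ((s - a) ^ _)]
        rw [hsum, add_sub_add_comm, ← smul_sub, ← Finset.sum_sub_distrib]
        simp_rw [← smul_sub]
        refine (norm_add_le _ _).trans ?_
        have e1 : ‖(r : ℝ) • (s ^ (r - 1) • g (dilation d s (x, k)) -
            ∑ l ∈ Finset.range N, (s - a) ^ l • q₁ l)‖ ≤ r * (C₁ * M * (b - a) ^ N) := by
          rw [norm_smul, Real.norm_natCast]
          exact mul_le_mul_of_nonneg_left (hq₁ s hs) (Nat.cast_nonneg r)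
        have e2 : ‖∑ i, x i • (s ^ r • pdir (dirXK d (Sum.inl i)) g (dilation d s (x, k)) -
            ∑ l ∈ Finset.range N, (s - a) ^ l • q₂ i l)‖ ≤
            ∑ _i : Fin d, 2 * (C₂ * M * (b - a) ^ N) := by
          refine norm_sum_le_of_le _ fun i _ => ?_
          rw [norm_smul]
          exact mul_le_mul ((PiLp.norm_apply_le x i).trans hx) (hq₂ i s hs) (norm_nonneg _)
            zero_le_two
        refine (add_le_add e1 e2).trans_eq ?_
        simp only [Finset.sum_const, nsmul_eq_mul]
        ring⟩
    refine ⟨q, fun s hs => (hq s hs).trans_eq ?_⟩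
    ring

end Dilation

section Cutoff

variable {d : ℕ}

/-- The standard basis directions of `ℝ^d`. -/
def dirStd (d : ℕ) (i : Fin d) : EuclideanSpace ℝ (Fin d) := EuclideanSpace.single i 1

/-- A sequence of cutoffs supported at distance `4⁻ⁿ` from the unit ball, with derivatives
growing as dictated by this scale, up to `p` additional derivatives. -/
structure ScaledCutoff (p : ℕ) (χ : ℕ → EuclideanSpace ℝ (Fin d) → ℝ) : Prop where
  smooth : ∀ n, ContDiff ℝ (⊤ : ℕ∞) (χ n)
  supp : ∀ n, ∀ x ∈ tsupport (χ n), (1 - (1 / 4 : ℝ) ^ (n + 1)) * ‖x‖ < 1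
  bound : ∀ L : List (Fin d), ∃ C : ℝ, ∀ n x,
    |wordDeriv (dirStd d) L (χ n) x| ≤ C * 4 ^ (n * (p + L.length))

lemma ScaledCutoff.pdir {p : ℕ} {χ : ℕ → EuclideanSpace ℝ (Fin d) → ℝ} (h : ScaledCutoff p χ)
    (i : Fin d) : ScaledCutoff (p + 1) fun n => pdir (dirStd d i) (χ n) where
  smooth n := (h.smooth n).pdir _
  supp n x hx := h.supp n x (tsupport_fderiv_apply_subset ℝ _ hx)
  bound L := by
    obtain ⟨C, hC⟩ := h.bound (i :: L)
    refine ⟨C, fun n x => (hC n x).trans_eq ?_⟩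
    rw [List.length_cons]
    ring_nf

/-- The argument of the cutoff at scale `4⁻ⁿ`. -/
def cutoffArg (n : ℕ) (x : EuclideanSpace ℝ (Fin d)) : ℝ := 2 - 4 ^ (n + 1) * (‖x‖ ^ 2 - 1)

/-- A smooth function equal to `1` on the unit ball, supported at distance `4⁻ⁿ` from it. -/
def cutoff (n : ℕ) (x : EuclideanSpace ℝ (Fin d)) : ℝ := Real.smoothTransition (cutoffArg n x)

lemma contDiff_cutoffArg (n : ℕ) :
    ContDiff ℝ (⊤ : ℕ∞) (cutoffArg n : EuclideanSpace ℝ (Fin d) → ℝ) :=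
  contDiff_const.sub (contDiff_const.mul ((contDiff_norm_sq ℝ).sub contDiff_const))

lemma norm_sq_le_of_cutoffArg_nonneg {n : ℕ} {x : EuclideanSpace ℝ (Fin d)}
    (h : 0 ≤ cutoffArg n x) : ‖x‖ ^ 2 ≤ 1 + 2 * (1 / 4) ^ (n + 1) := by
  have h4 : (4 : ℝ) ^ (n + 1) * (1 / 4) ^ (n + 1) = 1 := by rw [← mul_pow]; norm_num
  have hp : (0 : ℝ) < (1 / 4) ^ (n + 1) := by positivity
  unfold cutoffArg at h
  nlinarith [mul_nonneg hp.le h]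

lemma norm_le_two_of_cutoffArg_nonneg {n : ℕ} {x : EuclideanSpace ℝ (Fin d)}
    (h : 0 ≤ cutoffArg n x) : ‖x‖ ≤ 2 := by
  have h1 := norm_sq_le_of_cutoffArg_nonneg h
  have h2 : (1 / 4 : ℝ) ^ (n + 1) ≤ 1 := pow_le_one₀ (by norm_num) (by norm_num)
  nlinarith

lemma fderiv_cutoffArg_dirStd (n : ℕ) (x : EuclideanSpace ℝ (Fin d)) (i : Fin d) :
    fderiv ℝ (cutoffArg n) x (dirStd d i) = 4 ^ n * (-8 * x i) := by
  have h1 : HasFDerivAt (cutoffArg n) _ x :=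
    (((hasStrictFDerivAt_norm_sq x).hasFDerivAt.sub_const 1).const_mul
      ((4 : ℝ) ^ (n + 1))).const_sub 2
  rw [h1.fderiv]
  simp [dirStd, EuclideanSpace.inner_single_right]
  ring

lemma exists_wordDeriv_comp_cutoffArg_bound (L : List (Fin d)) {θ : ℝ → ℝ}
    (hθ : ContDiff ℝ (⊤ : ℕ∞) θ) (h0 : ∀ s < 0, θ s = 0) (h1 : ∃ c, ∀ s > 1, θ s = c)
    {P : EuclideanSpace ℝ (Fin d) → ℝ} (hP : ContDiff ℝ (⊤ : ℕ∞) P) :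
    ∃ C : ℝ, ∀ n x,
      |wordDeriv (dirStd d) L (fun y => θ (cutoffArg n y) * P y) x| ≤ C * 4 ^ (n * L.length) := by
  induction L generalizing θ P with
  | nil =>
    obtain ⟨c, hc⟩ := h1
    obtain ⟨A, hA⟩ := (isCompact_Icc (a := (0 : ℝ)) (b := 1)).exists_bound_of_continuousOn
      hθ.continuous.continuousOn
    obtain ⟨B, hB⟩ :=
      (isCompact_closedBall (0 : EuclideanSpace ℝ (Fin d)) 2).exists_bound_of_continuousOn
      hP.continuous.continuousOn
    refine ⟨(|A| + |c|) * |B|, fun n x => ?_⟩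
    simp only [wordDeriv_nil, List.length_nil, mul_zero, pow_zero, mul_one, abs_mul]
    rcases lt_or_ge (cutoffArg n x) 0 with h | h
    · rw [h0 _ h, abs_zero, zero_mul]; positivity
    · have hx : |P x| ≤ |B| := (hB x (by simpa using norm_le_two_of_cutoffArg_nonneg h)).trans
        (le_abs_self B)
      refine mul_le_mul ?_ hx (abs_nonneg _) (by positivity)
      rcases lt_or_ge 1 (cutoffArg n x) with h' | h'
      · rw [hc _ h']; linarith [abs_nonneg A]
      · have := (hA _ ⟨h, h'⟩).trans (le_abs_self A)
        rw [Real.norm_eq_abs] at this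
        linarith [abs_nonneg c]
  | cons i L ih =>
    have hθ' : ContDiff ℝ (⊤ : ℕ∞) (deriv θ) :=
      (contDiff_succ_iff_deriv (n := ((⊤ : ℕ∞) : WithTop ℕ∞))).1 (by simpa using hθ) |>.2.2
    have h0' : ∀ s < 0, deriv θ s = 0 := fun s hs => by
      have : θ =ᶠ[nhds s] fun _ => 0 := Filter.eventuallyEq_of_mem (Iio_mem_nhds hs) h0
      rw [this.deriv_eq, deriv_const]
    have h1' : ∃ c, ∀ s > 1, deriv θ s = c := by
      obtain ⟨c, hc⟩ := h1
      refine ⟨0, fun s hs => ?_⟩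
      have : θ =ᶠ[nhds s] fun _ => c := Filter.eventuallyEq_of_mem (Ioi_mem_nhds hs) hc
      rw [this.deriv_eq, deriv_const]
    have hcoord : ContDiff ℝ (⊤ : ℕ∞) fun y : EuclideanSpace ℝ (Fin d) => y i :=
      (EuclideanSpace.proj (𝕜 := ℝ) i).contDiff
    have hP' : ContDiff ℝ (⊤ : ℕ∞) fun y : EuclideanSpace ℝ (Fin d) => (-8 * y i) * P y :=
      (contDiff_const.mul hcoord).mul hP
    obtain ⟨C₁, hC₁⟩ := ih hθ' h0' h1' hP'
    obtain ⟨C₂, hC₂⟩ := ih hθ h0 h1 (hP.pdir (dirStd d i))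
    refine ⟨|C₁| + |C₂|, fun n x => ?_⟩
    have hstep : pdir (dirStd d i) (fun y => θ (cutoffArg n y) * P y) =
        (4 : ℝ) ^ n • (fun y => deriv θ (cutoffArg n y) * ((-8 * y i) * P y)) +
          fun y => θ (cutoffArg n y) * pdir (dirStd d i) P y := by
      ext y
      have e1 : HasFDerivAt (fun y => θ (cutoffArg n y))
          (deriv θ (cutoffArg n y) • fderiv ℝ (cutoffArg n) y) y :=
        ((hθ.differentiable (by simp) _).hasDerivAt).comp_hasFDerivAt y
          (((contDiff_cutoffArg n).differentiable (by simp) y).hasFDerivAt)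
      have e2 := (hP.differentiable (by simp) y).hasFDerivAt
      rw [pdir, (e1.fun_mul e2).fderiv]
      simp [fderiv_cutoffArg_dirStd, pdir]
      ring
    rw [wordDeriv_cons, hstep, wordDeriv_add, wordDeriv_const_smul]
    · have hpow : (4 : ℝ) ^ (n * (i :: L).length) = 4 ^ n * 4 ^ (n * L.length) := by
        rw [← pow_add, List.length_cons]; ring_nf
      have hone : (1 : ℝ) ≤ 4 ^ n := one_le_pow₀ (by norm_num)
      have hpos : (0 : ℝ) < 4 ^ (n * L.length) := by positivity
      have b1 : |wordDeriv (dirStd d) L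
          (fun y => deriv θ (cutoffArg n y) * ((-8 * y i) * P y)) x| ≤ |C₁| * 4 ^ (n * L.length) :=
        (hC₁ n x).trans (mul_le_mul_of_nonneg_right (le_abs_self _) hpos.le)
      have b2 : |wordDeriv (dirStd d) L
          (fun y => θ (cutoffArg n y) * pdir (dirStd d i) P y) x| ≤ |C₂| * 4 ^ (n * L.length) :=
        (hC₂ n x).trans (mul_le_mul_of_nonneg_right (le_abs_self _) hpos.le)
      rw [Pi.add_apply, Pi.smul_apply, smul_eq_mul, hpow]
      refine (abs_add_le _ _).trans ?_
      rw [abs_mul, abs_of_pos (by positivity : (0 : ℝ) < 4 ^ n)]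
      calc (4 : ℝ) ^ n * _ + _
          ≤ 4 ^ n * (|C₁| * 4 ^ (n * L.length)) + 4 ^ n * (|C₂| * 4 ^ (n * L.length)) := by
            refine add_le_add (mul_le_mul_of_nonneg_left b1 (by positivity)) (b2.trans ?_)
            exact le_mul_of_one_le_left (by positivity) hone
        _ = _ := by ring
    · exact (hθ'.comp (contDiff_cutoffArg n)).mul hP'
    · exact ContDiff.const_smul ((4 : ℝ) ^ n) ((hθ'.comp (contDiff_cutoffArg n)).mul hP')
    · exact (hθ.comp (contDiff_cutoffArg n)).mul (hP.pdir _)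

lemma scaledCutoff_cutoff : ScaledCutoff 0 (cutoff : ℕ → EuclideanSpace ℝ (Fin d) → ℝ) where
  smooth n := Real.smoothTransition.contDiff.comp (contDiff_cutoffArg n)
  supp n x hx := by
    have hcl : IsClosed {y : EuclideanSpace ℝ (Fin d) | 0 ≤ cutoffArg n y} :=
      isClosed_le continuous_const (contDiff_cutoffArg n).continuous
    have hsub : tsupport (cutoff n) ⊆ {y : EuclideanSpace ℝ (Fin d) | 0 ≤ cutoffArg n y} :=
      closure_minimal (fun y hy => le_of_not_ge fun h =>
        hy (Real.smoothTransition.zero_of_nonpos h)) hcl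
    have h1 := norm_sq_le_of_cutoffArg_nonneg (hsub hx)
    have hp : (0 : ℝ) < (1 / 4) ^ (n + 1) := by positivity
    have hp1 : (1 / 4 : ℝ) ^ (n + 1) < 1 := pow_lt_one₀ (by norm_num) (by norm_num) (by simp)
    refine lt_of_pow_lt_pow_left₀ 2 zero_le_one ?_
    rw [mul_pow, one_pow]
    set δ : ℝ := (1 / 4) ^ (n + 1)
    calc (1 - δ) ^ 2 * ‖x‖ ^ 2 ≤ (1 - δ) ^ 2 * (1 + 2 * δ) := by gcongr
      _ = 1 - δ ^ 2 * (1 + 2 * (1 - δ)) := by ring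
      _ < 1 := by
        have : 0 < δ ^ 2 * (1 + 2 * (1 - δ)) := by
          have : 0 < 1 - δ := by linarith
          positivity
        linarith
  bound L := by
    obtain ⟨C, hC⟩ := exists_wordDeriv_comp_cutoffArg_bound (d := d) L
      Real.smoothTransition.contDiff (fun s hs => Real.smoothTransition.zero_of_nonpos hs.le)
      ⟨1, fun s hs => Real.smoothTransition.one_of_one_le hs.le⟩ (P := fun _ => 1) contDiff_const
    refine ⟨C, fun n x => ?_⟩
    have h := hC n x
    simp only [mul_one] at h
    rw [zero_add]
    exact h

lemma cutoff_eq_one {n : ℕ} {x : EuclideanSpace ℝ (Fin d)} (hx : ‖x‖ < 1) : cutoff n x = 1 := by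
  refine Real.smoothTransition.one_of_one_le ?_
  have : ‖x‖ ^ 2 ≤ 1 := pow_le_one₀ (norm_nonneg x) hx.le
  have h4 : (0 : ℝ) < 4 ^ (n + 1) := by positivity
  unfold cutoffArg
  nlinarith

end Cutoff

section Extension

variable {d : ℕ}

lemma extrapNode_smul_mem {p : ℕ} {χ : ℕ → EuclideanSpace ℝ (Fin d) → ℝ} (hχ : ScaledCutoff p χ)
    (n : ℕ) : ∀ x ∈ tsupport (χ n), ∀ j,
      extrapNode n j • x ∈ Metric.ball (0 : EuclideanSpace ℝ (Fin d)) 1 := by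
  intro x hx j
  have hj := extrapNode_mem n j
  have h0 : 0 ≤ extrapNode n j := by
    have := (le_max_left _ _).trans hj.1
    linarith
  rw [mem_ball_zero_iff, norm_smul, Real.norm_of_nonneg h0]
  exact (mul_le_mul_of_nonneg_right hj.2 (norm_nonneg x)).trans_lt (hχ.supp n x hx)

lemma ScaledCutoff.contDiff_dilSum {p : ℕ} {χ : ℕ → EuclideanSpace ℝ (Fin d) → ℝ}
    (hχ : ScaledCutoff p χ) {g : Phase d → ℂ} (hg : ContDiffOn ℝ (⊤ : ℕ∞) g (ballPhase d))
    (r n : ℕ) :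
    ContDiff ℝ (⊤ : ℕ∞) (dilSum (extrapCoef n) (extrapNode n) (χ n) r g) :=
  _root_.contDiff_dilSum (hχ.smooth n) (extrapNode_smul_mem hχ n) hg r

lemma norm_extrap_ray_le (p r : ℕ) : ∃ K : ℝ, 0 ≤ K ∧ ∀ g : Phase d → ℂ,
    ContDiffOn ℝ (⊤ : ℕ∞) g (ballPhase d) → ∀ (k : EuclideanSpace ℝ (Fin d)) (M : ℝ),
    (∀ L : List (Fin d), L.length ≤ p → ∀ z ∈ Metric.ball (0 : EuclideanSpace ℝ (Fin d)) 1,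
      ‖wordDeriv (dirXK d) (L.map Sum.inl) g (z, k)‖ ≤ M) →
    ∀ (n : ℕ) (x : EuclideanSpace ℝ (Fin d)), (1 - (1 / 4 : ℝ) ^ (n + 1)) * ‖x‖ < 1 →
      ‖∑ j, extrapCoef n j • (extrapNode n j ^ r • g (dilation d (extrapNode n j) (x, k)))‖ ≤
        2 ^ (n + 2) * (K * M * ((n + 1) * (1 / 4) ^ n) ^ p) := by
  obtain ⟨C, hC, h⟩ := exists_poly_approx_ray (d := d) p r
  obtain ⟨C₀, hC₀, h₀⟩ := exists_poly_approx_ray (d := d) 0 r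
  refine ⟨C + C₀ * (4 ^ p) ^ p, by positivity, fun g hg k M hM n x hx => ?_⟩
  have hM0 : 0 ≤ M := (norm_nonneg _).trans
    (hM [] (Nat.zero_le _) 0 (Metric.mem_ball_self one_pos))
  set a : ℝ := max (3 / 4) (1 - (n + 1) * (1 / 4 : ℝ) ^ n) with ha
  set b : ℝ := 1 - (1 / 4 : ℝ) ^ (n + 1) with hb
  have hpow : (0 : ℝ) < (1 / 4) ^ n := by positivity
  have hpow1 : (1 / 4 : ℝ) ^ n ≤ 1 := pow_le_one₀ (by norm_num) (by norm_num)
  have hb' : b = 1 - (1 / 4 : ℝ) ^ n / 4 := by rw [hb, pow_succ]; ring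
  have ha0 : 0 ≤ a := le_trans (by norm_num) (le_max_left _ _)
  have hab : a ≤ b := (extrapNode_mem n (Sum.inl 0)).1.trans (extrapNode_mem n (Sum.inl 0)).2
  have hb1 : b ≤ 1 := by linarith
  have hx2 : ‖x‖ ≤ 2 := by
    have h34 : (3 / 4 : ℝ) ≤ b := by linarith
    nlinarith [mul_le_mul_of_nonneg_right h34 (norm_nonneg x)]
  have hba : b - a ≤ (n + 1) * (1 / 4) ^ n := by
    have := le_max_right (3 / 4) (1 - (n + 1) * (1 / 4 : ℝ) ^ n)
    linarith
  set ρ : ℝ := (n + 1) * (1 / 4) ^ n with hρ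
  have hρ0 : 0 < ρ := by positivity
  rcases le_or_gt p n with hpn | hpn
  · obtain ⟨q, hq⟩ := h g hg x k a b M ha0 hab hb1 hx hx2 hM
    have := norm_sum_smul_le_of_poly_approx (extrapNode_mem n)
      (fun i hi => sum_extrapCoef_mul_pow (hi.trans_le hpn) a) hq
    refine this.trans (mul_le_mul (sum_abs_extrapCoef_le n) ?_ (by
      have : 0 ≤ b - a := sub_nonneg.2 hab
      positivity) (by positivity))
    have hba0 : 0 ≤ b - a := sub_nonneg.2 hab
    gcongr
    linarith [show 0 ≤ C₀ * (4 ^ p : ℝ) ^ p by positivity]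
  · obtain ⟨q, hq⟩ := h₀ g hg x k a b M ha0 hab hb1 hx hx2
      fun L hL => hM L (hL.trans (Nat.zero_le p))
    have := norm_sum_smul_le_of_poly_approx (c := extrapCoef n) (extrapNode_mem n)
      (fun i hi => absurd hi (Nat.not_lt_zero i)) hq
    rw [pow_zero, mul_one] at this
    refine this.trans (mul_le_mul (sum_abs_extrapCoef_le n) ?_ (by positivity) (by positivity))
    have hone : 1 ≤ 4 ^ p * ρ := by
      have h1 : (4 : ℝ) ^ n * (1 / 4) ^ n = 1 := by rw [← mul_pow]; norm_num
      have h2 : (4 : ℝ) ^ n ≤ 4 ^ p := pow_le_pow_right₀ (by norm_num) hpn.le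
      have h3 : (1 / 4 : ℝ) ^ n ≤ ρ := le_mul_of_one_le_left hpow.le (by simp)
      rw [← h1]
      gcongr
    calc C₀ * M ≤ C₀ * M * (4 ^ p * ρ) ^ p :=
          le_mul_of_one_le_right (by positivity) (one_le_pow₀ hone)
      _ = C₀ * (4 ^ p) ^ p * M * ρ ^ p := by rw [mul_pow]; ring
      _ ≤ (C + C₀ * (4 ^ p) ^ p) * M * ρ ^ p := by
          gcongr
          linarith

lemma summable_succ_pow_mul_half_pow (N : ℕ) :
    Summable fun n : ℕ => ((n : ℝ) + 1) ^ N * (1 / 2 : ℝ) ^ n := by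
  have h := (summable_nat_add_iff 1).2
    (summable_pow_mul_geometric_of_norm_lt_one N (r := (1 / 2 : ℝ)) (by norm_num))
  refine (h.mul_left 2).congr fun n => ?_
  push_cast
  ring

lemma ScaledCutoff.dilSum_bound {p : ℕ} {χ : ℕ → EuclideanSpace ℝ (Fin d) → ℝ}
    (hχ : ScaledCutoff p χ) (r : ℕ) : ∃ (v : ℕ → ℝ) (N : ℕ), Summable v ∧ ∀ g : Phase d → ℂ,
    ContDiffOn ℝ (⊤ : ℕ∞) g (ballPhase d) → ∀ (k : EuclideanSpace ℝ (Fin d)) (M : ℝ),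
    (∀ L : List (Fin d), L.length ≤ N → ∀ z ∈ Metric.ball (0 : EuclideanSpace ℝ (Fin d)) 1,
      ‖wordDeriv (dirXK d) (L.map Sum.inl) g (z, k)‖ ≤ M) →
    ∀ n x, ‖dilSum (extrapCoef n) (extrapNode n) (χ n) r g (x, k)‖ ≤ v n * M := by
  obtain ⟨K, hK, h⟩ := norm_extrap_ray_le (d := d) (p + 1) r
  obtain ⟨C, hC⟩ := hχ.bound []
  refine ⟨fun n => 4 * |C| * K * (((n : ℝ) + 1) ^ (p + 1) * (1 / 2) ^ n), p + 1,
    (summable_succ_pow_mul_half_pow (p + 1)).mul_left _, fun g hg k M hM n x => ?_⟩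
  have hM0 : 0 ≤ M := (norm_nonneg _).trans
    (hM [] (Nat.zero_le _) 0 (Metric.mem_ball_self one_pos))
  by_cases hx : x ∈ tsupport (χ n)
  · have h1 := h g hg k M hM n x (hχ.supp n x hx)
    have h2 : |χ n x| ≤ |C| * 4 ^ (n * p) :=
      (hC n x).trans (mul_le_mul_of_nonneg_right (le_abs_self C) (by positivity))
    rw [dilSum, norm_smul, Real.norm_eq_abs]
    refine (mul_le_mul h2 h1 (norm_nonneg _) (by positivity)).trans_eq ?_
    have h3 : (4 : ℝ) ^ (n * p) * 2 ^ n * ((1 / 4) ^ n) ^ (p + 1) = (1 / 2) ^ n := by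
      rw [pow_mul, pow_succ, ← mul_assoc, mul_right_comm ((4 ^ n : ℝ) ^ p), ← mul_pow, ← mul_pow,
        mul_assoc, ← mul_pow]
      norm_num
    beta_reduce
    rw [← h3, mul_pow, pow_add 2 n 2]
    ring
  · have h0 : χ n x = 0 := image_eq_zero_of_notMem_tsupport hx
    rw [dilSum, h0, zero_smul, norm_zero]
    positivity

lemma ScaledCutoff.wordDeriv_dilSum_bound {p : ℕ} {χ : ℕ → EuclideanSpace ℝ (Fin d) → ℝ}
    (hχ : ScaledCutoff p χ) (r : ℕ) (L : List (Fin d ⊕ Fin d)) :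
    ∃ (v : ℕ → ℝ) (N : ℕ), Summable v ∧ ∀ g : Phase d → ℂ,
    ContDiffOn ℝ (⊤ : ℕ∞) g (ballPhase d) → ∀ (k : EuclideanSpace ℝ (Fin d)) (M : ℝ),
    (∀ L' : List (Fin d ⊕ Fin d), L'.length ≤ N →
      (∀ j, L'.count (Sum.inr j) = L.count (Sum.inr j)) →
      ∀ z ∈ Metric.ball (0 : EuclideanSpace ℝ (Fin d)) 1,
        ‖wordDeriv (dirXK d) L' g (z, k)‖ ≤ M) →
    ∀ n x, ‖wordDeriv (dirXK d) L (dilSum (extrapCoef n) (extrapNode n) (χ n) r g) (x, k)‖ ≤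
      v n * M := by
  induction L generalizing p χ r with
  | nil =>
    obtain ⟨v, N, hv, h⟩ := hχ.dilSum_bound r
    refine ⟨v, N, hv, fun g hg k M hM => h g hg k M fun L hL =>
      hM _ (by rwa [List.length_map]) fun j => ?_⟩
    rw [List.count_nil]
    exact List.count_eq_zero_of_not_mem (by simp)
  | cons i L ih =>
    rcases i with i | i
    · obtain ⟨v₁, N₁, hv₁, h₁⟩ := ih (hχ.pdir i) r
      obtain ⟨v₂, N₂, hv₂, h₂⟩ := ih hχ (r + 1)
      refine ⟨fun n => v₁ n + v₂ n, max N₁ (N₂ + 1), hv₁.add hv₂, fun g hg k M hM n x => ?_⟩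
      have hg' := hg.pdir isOpen_ballPhase (dirXK d (Sum.inl i))
      have e₁ := h₁ g hg k M (fun L' hL' hc => hM L' (hL'.trans (le_max_left _ _))
        fun j => by rw [hc j, List.count_cons_of_ne (by simp)]) n x
      have e₂ := h₂ _ hg' k M (fun L' hL' hc => hM (Sum.inl i :: L')
        ((Nat.succ_le_succ hL').trans (le_max_right _ _))
        fun j => by rw [List.count_cons_of_ne (by simp), hc j, List.count_cons_of_ne (by simp)]) n x
      have hstep : _root_.pdir (dirXK d (Sum.inl i))
          (dilSum (extrapCoef n) (extrapNode n) (χ n) r g) =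
            dilSum (extrapCoef n) (extrapNode n) (_root_.pdir (dirStd d i) (χ n)) r g +
              dilSum (extrapCoef n) (extrapNode n) (χ n) (r + 1)
                (_root_.pdir (dirXK d (Sum.inl i)) g) :=
        pdir_inl_dilSum (hχ.smooth n) (extrapNode_smul_mem hχ n) hg r i
      beta_reduce
      rw [wordDeriv_cons, hstep, wordDeriv_add ((hχ.pdir i).contDiff_dilSum hg r n)
        (hχ.contDiff_dilSum hg' (r + 1) n), add_mul]
      exact (norm_add_le _ _).trans (add_le_add e₁ e₂)
    · obtain ⟨v, N, hv, h⟩ := ih hχ r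
      refine ⟨v, N + 1, hv, fun g hg k M hM n x => ?_⟩
      rw [wordDeriv_cons, pdir_inr_dilSum (hχ.smooth n) (extrapNode_smul_mem hχ n) hg]
      exact h _ (hg.pdir isOpen_ballPhase _) k M (fun L' hL' hc => hM (Sum.inr i :: L')
        (Nat.succ_le_succ hL') fun j => by rw [List.count_cons, List.count_cons, hc j]) n x

/-- The `n`-th term of the series defining the extension operator. -/
def extTerm (a : Phase d → ℂ) (n : ℕ) : Phase d → ℂ :=
  dilSum (extrapCoef n) (extrapNode n) (cutoff n) 0 a

lemma contDiff_extTerm {a : Phase d → ℂ} (ha : ContDiffOn ℝ (⊤ : ℕ∞) a (ballPhase d)) (n : ℕ) :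
    ContDiff ℝ (⊤ : ℕ∞) (extTerm a n) :=
  scaledCutoff_cutoff.contDiff_dilSum ha 0 n

lemma exists_wordDeriv_extTerm_bound (L : List (Fin d ⊕ Fin d)) :
    ∃ (v : ℕ → ℝ) (N : ℕ), Summable v ∧ ∀ a : Phase d → ℂ,
    ContDiffOn ℝ (⊤ : ℕ∞) a (ballPhase d) → ∀ (k : EuclideanSpace ℝ (Fin d)) (M : ℝ),
    (∀ α : Fin d → Fin (N + 1), ∀ z ∈ Metric.ball (0 : EuclideanSpace ℝ (Fin d)) 1,
      ‖Dmix d (fun j => α j) (fun j => L.count (Sum.inr j)) a (z, k)‖ ≤ M) →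
    ∀ n x, ‖wordDeriv (dirXK d) L (extTerm a n) (x, k)‖ ≤ v n * M := by
  obtain ⟨v, N, hv, h⟩ := (scaledCutoff_cutoff (d := d)).wordDeriv_dilSum_bound 0 L
  refine ⟨v, N, hv, fun a ha k M hM => h a ha k M fun L' hL' hc z hz => ?_⟩
  have hmem : ((z, k) : Phase d) ∈ ballPhase d := ⟨hz, trivial⟩
  have key := wordDeriv_eq_Dmix L' isOpen_ballPhase ha hmem
  rw [funext hc] at key
  rw [key]
  exact hM (fun j =>
    ⟨L'.count (Sum.inl j), Nat.lt_succ_of_le (List.count_le_length.trans hL')⟩) z hz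

lemma SymbOn.exists_Dmix_bound {m : ℝ} {a : Phase d → ℂ}
    (ha : SymbOn d (Metric.ball 0 1) m a) (N : ℕ) (β : Fin d → ℕ) :
    ∃ C : ℝ, 0 ≤ C ∧ ∀ α : Fin d → Fin (N + 1), ∀ p ∈ ballPhase d,
      ‖Dmix d (fun j => α j) β a p‖ ≤ C * (1 + ‖p.2‖ ^ 2) ^ ((m - ∑ j, (β j : ℝ)) / 2) := by
  choose C hC using fun α : Fin d → Fin (N + 1) => ha.2 (fun j => α j) β
  refine ⟨∑ α, |C α|, Finset.sum_nonneg fun _ _ => abs_nonneg _, fun α p hp => ?_⟩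
  refine (hC α p hp).trans (mul_le_mul_of_nonneg_right ?_ (by positivity))
  exact (le_abs_self _).trans
    (Finset.single_le_sum (f := fun α => |C α|) (fun _ _ => abs_nonneg _) (Finset.mem_univ α))

lemma one_add_norm_sq_rpow_le {k : EuclideanSpace ℝ (Fin d)} {R : ℝ} (hk : ‖k‖ < R) (s : ℝ) :
    (1 + ‖k‖ ^ 2) ^ s ≤ (1 + R ^ 2) ^ |s| := by
  have h1 : 1 ≤ 1 + ‖k‖ ^ 2 := le_add_of_nonneg_right (by positivity)
  refine (Real.rpow_le_rpow_of_exponent_le h1 (le_abs_self s)).trans ?_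
  have h0 := norm_nonneg k
  exact Real.rpow_le_rpow (by positivity) (by gcongr) (abs_nonneg s)

lemma SymbOn.summableDeriv_extTerm {m : ℝ} {a : Phase d → ℂ}
    (ha : SymbOn d (Metric.ball 0 1) m a) : SummableDeriv (extTerm a) where
  smooth := contDiff_extTerm ha.1
  bound L R := by
    obtain ⟨v, N, hv, h⟩ := exists_wordDeriv_extTerm_bound L
    obtain ⟨C, hC, hCa⟩ := ha.exists_Dmix_bound N fun j => L.count (Sum.inr j)
    refine ⟨_, hv.mul_right
      (C * (1 + R ^ 2) ^ |(m - ∑ j, (L.count (Sum.inr j : Fin d ⊕ Fin d) : ℝ)) / 2|),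
      fun n p hp => h a ha.1 p.2 _ (fun α z hz => ?_) n p.1⟩
    exact (hCa α (z, p.2) ⟨hz, trivial⟩).trans
      (mul_le_mul_of_nonneg_left (one_add_norm_sq_rpow_le hp _) hC)

/-- The extension operator from the unit ball, by regularised polynomial extrapolation along
rays. -/
def symbolExt (a : Phase d → ℂ) : Phase d → ℂ := fun p => ∑' n, extTerm a n p

lemma exists_Dmix_symbolExt_bound (α β : Fin d → ℕ) :
    ∃ (C : ℝ) (N : ℕ), ∀ (m : ℝ) (a : Phase d → ℂ),
    SymbOn d (Metric.ball 0 1) m a → ∀ (k : EuclideanSpace ℝ (Fin d)) (M : ℝ),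
    (∀ α' : Fin d → Fin (N + 1), ∀ z ∈ Metric.ball (0 : EuclideanSpace ℝ (Fin d)) 1,
      ‖Dmix d (fun j => α' j) β a (z, k)‖ ≤ M) →
    ∀ x, ‖Dmix d α β (symbolExt a) (x, k)‖ ≤ C * M := by
  obtain ⟨v, N, hv, h⟩ := exists_wordDeriv_extTerm_bound (mixWord α β)
  simp only [count_inr_mixWord] at h
  refine ⟨∑' n, v n, N, fun m a ha k M hM x => ?_⟩
  have hw := congrFun (ha.summableDeriv_extTerm.wordDeriv_tsum (mixWord α β)) (x, k)
  rw [Dmix_eq_wordDeriv]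
  unfold symbolExt
  rw [hw]
  exact tsum_of_norm_bounded (hv.hasSum.mul_right M) fun n => h a ha.1 k M hM n x

lemma symbolExt_eq_of_mem_ball {m : ℝ} {a : Phase d → ℂ} (ha : SymbOn d (Metric.ball 0 1) m a)
    {p : Phase d} (hp : p.1 ∈ Metric.ball (0 : EuclideanSpace ℝ (Fin d)) 1) :
    symbolExt a p = a p := by
  have hd : DifferentiableAt ℝ (fun s : ℝ => a (dilation d s p)) 1 := by
    have h1 : dilation d 1 p = p := by simp [dilation_apply]
    have hap : DifferentiableAt ℝ a (dilation d 1 p) := by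
      rw [h1]
      exact (ha.1.contDiffAt (isOpen_ballPhase.mem_nhds ⟨hp, trivial⟩)).differentiableAt (by simp)
    refine hap.comp (1 : ℝ) ?_
    simp only [dilation_apply]
    fun_prop
  have hlim := tendsto_extrap hd
  have hterm : ∀ n, extTerm a n p =
      extrap (n + 1) (fun s => a (dilation d s p)) - extrap n (fun s => a (dilation d s p)) := by
    intro n
    rw [← sum_extrapCoef_smul, extTerm, dilSum, cutoff_eq_one (by simpa using hp)]
    simp
  have hsum_range : ∀ n, ∑ i ∈ Finset.range n, extTerm a i p =
      extrap n (fun s => a (dilation d s p)) := by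
    intro n
    simp only [hterm]
    rw [Finset.sum_range_sub (fun n => extrap n (fun s => a (dilation d s p)))]
    simp [extrap]
  have hsum := (ha.summableDeriv_extTerm.summable p).hasSum.tendsto_sum_nat
  simp only [hsum_range] at hsum
  refine (tendsto_nhds_unique hsum hlim).trans ?_
  simp [dilation_apply]

lemma extTerm_add (a b : Phase d → ℂ) (n : ℕ) : extTerm (a + b) n = extTerm a n + extTerm b n := by
  ext p
  simp [extTerm, dilSum, Finset.sum_add_distrib]

lemma extTerm_smul (z : ℂ) (a : Phase d → ℂ) (n : ℕ) : extTerm (z • a) n = z • extTerm a n := by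
  ext p
  simp only [extTerm, dilSum, Pi.smul_apply, smul_comm (_ : ℝ) z, ← Finset.smul_sum]

lemma SymbOn.symbolExt {m : ℝ} {a : Phase d → ℂ} (ha : SymbOn d (Metric.ball 0 1) m a) :
    SymbOn d Set.univ m (symbolExt a) := by
  refine ⟨ha.summableDeriv_extTerm.contDiff_tsum.contDiffOn, fun α β => ?_⟩
  obtain ⟨C, N, h⟩ := exists_Dmix_symbolExt_bound α β
  obtain ⟨D, -, hD⟩ := ha.exists_Dmix_bound N β
  refine ⟨C * D, fun p _ => ?_⟩
  rw [mul_assoc]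
  exact h m a ha p.2 _ (fun α' z hz => hD α' (z, p.2) ⟨hz, trivial⟩) p.1

end Extension

/-- (Extension of symbols from the unit ball.) There is a ℂ-linear map
`E : S^∞(T*B) → C^∞(ℝ^d × ℝ^d)` such that (1) `E` maps `S^m(T*B)` into `S^m(T*ℝ^d)` and
`(Ea)|_{B×ℝ^d} = a`; and (2) `E` is continuous for the symbol seminorms: for each `m, α, β`
there are a constant `C` and a finite family `(αᵢ, βᵢ)` of multi-index pairs such that the
`(α,β)`-seminorm of `Ea` is bounded by `C` times the max of the `(αᵢ,βᵢ)`-seminorms of `a`. -/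
theorem stmt15 (d : ℕ) :
    ∃ E : (EuclideanSpace ℝ (Fin d) × EuclideanSpace ℝ (Fin d) → ℂ) →
          (EuclideanSpace ℝ (Fin d) × EuclideanSpace ℝ (Fin d) → ℂ),
      -- ℂ-linearity on S^∞(T*B)
      (∀ a b, (∃ m, SymbOn d (Metric.ball 0 1) m a) → (∃ m, SymbOn d (Metric.ball 0 1) m b) →
        E (a + b) = E a + E b) ∧
      (∀ (z : ℂ) a, (∃ m, SymbOn d (Metric.ball 0 1) m a) → E (z • a) = z • E a) ∧
      -- (1): E maps S^m(T*B) into S^m(T*ℝ^d) and extends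
      (∀ (m : ℝ) a, SymbOn d (Metric.ball 0 1) m a →
        SymbOn d Set.univ m (E a) ∧
        ∀ p : EuclideanSpace ℝ (Fin d) × EuclideanSpace ℝ (Fin d),
          p.1 ∈ Metric.ball (0 : EuclideanSpace ℝ (Fin d)) 1 → E a p = a p) ∧
      -- (2): continuity for the symbol seminorms
      (∀ (m : ℝ) (α β : Fin d → ℕ),
        ∃ (C : ℝ) (N : ℕ) (I : Fin N → (Fin d → ℕ) × (Fin d → ℕ)),
          ∀ a, SymbOn d (Metric.ball 0 1) m a → ∀ D : ℝ,
            (∀ i : Fin N,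
              ∀ p ∈ (Metric.ball (0 : EuclideanSpace ℝ (Fin d)) 1) ×ˢ
                  (Set.univ : Set (EuclideanSpace ℝ (Fin d))),
                ‖Dmix d (I i).1 (I i).2 a p‖ ≤
                  D * (1 + ‖p.2‖ ^ 2) ^ ((m - ∑ j, ((I i).2 j : ℝ)) / 2)) →
            ∀ p : EuclideanSpace ℝ (Fin d) × EuclideanSpace ℝ (Fin d),
              ‖Dmix d α β (E a) p‖ ≤
                C * D * (1 + ‖p.2‖ ^ 2) ^ ((m - ∑ j, (β j : ℝ)) / 2)) := by
  refine ⟨symbolExt, ?_, ?_, ?_, ?_⟩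
  · rintro a b ⟨m, ha⟩ ⟨m', hb⟩
    ext p
    simp only [symbolExt, extTerm_add, Pi.add_apply]
    exact (ha.summableDeriv_extTerm.summable p).tsum_add (hb.summableDeriv_extTerm.summable p)
  · rintro z a -
    ext p
    simp only [symbolExt, extTerm_smul, Pi.smul_apply]
    exact tsum_const_smul'' z
  · exact fun m a ha => ⟨ha.symbolExt, fun p hp => symbolExt_eq_of_mem_ball ha hp⟩
  · intro m α β
    obtain ⟨C, N, h⟩ := exists_Dmix_symbolExt_bound (d := d) α β
    let e := Fintype.equivFin (Fin d → Fin (N + 1))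
    refine ⟨C, Fintype.card (Fin d → Fin (N + 1)), fun i => (fun j => e.symm i j, β),
      fun a ha D hD p => ?_⟩
    rw [mul_assoc]
    refine h m a ha p.2 _ (fun α' z hz => ?_) p.1
    simpa using hD (e α') (z, p.2) ⟨hz, trivial⟩
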